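/- For every θ ≥ 1 and w > 0, the local intrinsic dimensionality θ is recovered as the exponential of the Fisher–Rao distance to the one-dimensional uniform distribution: exp( | ∫_1^θ ( ∫₀^w (1/s + ln(r/w))² · (s/w)·(r/w)^{s−1} dr )^{1/2} ds | ) = θ. -/

import Mathlib

open Real

lemma continuousOn_log_mul_rpow {r : ℝ} (hr : 0 < r) :
    ContinuousOn (fun t : ℝ => Real.log t * t ^ r) (Set.Ici 0) := by
  intro t ht
  rcases (Set.mem_Ici.1 ht).eq_or_lt with rfl | ht
  · rw [← continuousWithinAt_Ioi_iff_Ici]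
    simpa [ContinuousWithinAt] using tendsto_log_mul_rpow_nhdsGT_zero hr
  · exact ((Real.continuousAt_log ht.ne').mul
      (Real.continuousAt_rpow_const t r (Or.inl ht.ne'))).continuousWithinAt

lemma hasDerivAt_rpow_mul_log_sq_add {s t : ℝ} (hs : s ≠ 0) (ht : 0 < t) :
    HasDerivAt (fun t : ℝ => t ^ s * (Real.log t ^ 2 + 1 / s ^ 2))
      ((1 / s + Real.log t) ^ 2 * (s * t ^ (s - 1))) t := by
  have h := (Real.hasDerivAt_rpow_const (p := s) (Or.inl ht.ne')).mul
    (((Real.hasDerivAt_log ht.ne').pow 2).add_const (1 / s ^ 2))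
  convert! h using 1
  rw [Real.rpow_sub_one ht.ne']
  simp
  field_simp
  ring

lemma continuousOn_rpow_mul_log_sq_add {s : ℝ} (hs : 0 < s) :
    ContinuousOn (fun t : ℝ => t ^ s * (Real.log t ^ 2 + 1 / s ^ 2)) (Set.Ici 0) := by
  refine (((continuousOn_log_mul_rpow (half_pos hs)).pow 2).add
    ((Real.continuous_rpow_const hs.le).continuousOn.mul
      (continuousOn_const (c := 1 / s ^ 2)))).congr fun t ht => ?_
  have h : (t ^ (s / 2)) ^ 2 = t ^ s := by
    rw [← Real.rpow_mul_natCast ht]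
    norm_num
  simp only [mul_pow, h, Pi.add_apply, Pi.pow_apply, Pi.mul_apply]
  ring

/-- The Fisher information of the smooth growth family on the unit interval. -/
lemma integral_sq_inv_add_log_mul_rpow {s : ℝ} (hs : 0 < s) :
    ∫ t in (0 : ℝ)..1, (1 / s + Real.log t) ^ 2 * (s * t ^ (s - 1)) = 1 / s ^ 2 := by
  have hc := (continuousOn_rpow_mul_log_sq_add hs).mono (Set.Icc_subset_Ici_self : Set.Icc (0 : ℝ) 1 ⊆ _)
  have hd (t : ℝ) (ht : t ∈ Set.Ioo (0 : ℝ) 1) := hasDerivAt_rpow_mul_log_sq_add hs.ne' ht.1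
  rw [intervalIntegral.integral_eq_sub_of_hasDerivAt_of_le zero_le_one hc hd]
  · simp [Real.zero_rpow hs.ne']
  · refine intervalIntegral.intervalIntegrable_deriv_of_nonneg (by simpa using hc)
      (by simpa using hd) fun t ht => ?_
    have ht : 0 < t := by simpa using ht.1
    positivity

/-- The Fisher information of the smooth growth family does not depend on the scale `w`. -/
lemma integral_sq_inv_add_log_div_mul_rpow {s w : ℝ} (hs : 0 < s) (hw : 0 < w) :
    ∫ r in (0 : ℝ)..w, (1 / s + Real.log (r / w)) ^ 2 * ((s / w) * (r / w) ^ (s - 1))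
      = 1 / s ^ 2 := by
  have h := intervalIntegral.integral_comp_div (a := 0) (b := w)
    (fun t : ℝ => (1 / s + Real.log t) ^ 2 * ((s / w) * t ^ (s - 1))) hw.ne'
  rw [h, zero_div, div_self hw.ne', smul_eq_mul, ← intervalIntegral.integral_const_mul,
    ← integral_sq_inv_add_log_mul_rpow hs]
  congr 1 with t
  field_simp

/-- For `θ ≥ 1`, the LID `θ` is the exponential of the Fisher–Rao distance between
`H_{w|θ}` and the one-dimensional uniform distribution `H_{w|1}`. -/
theorem stmt_12 (θ w : ℝ) (hθ : 1 ≤ θ) (hw : 0 < w) :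
    Real.exp
      |∫ s in (1:ℝ)..θ,
          Real.sqrt (∫ r in (0:ℝ)..w,
            (1 / s + Real.log (r / w)) ^ 2 * ((s / w) * (r / w) ^ (s - 1)))|
      = θ := by
  have hθ₀ : 0 < θ := zero_lt_one.trans_le hθ
  have h : Set.EqOn (fun s => Real.sqrt (∫ r in (0:ℝ)..w,
      (1 / s + Real.log (r / w)) ^ 2 * ((s / w) * (r / w) ^ (s - 1)))) (fun s => 1 / s)
      (Set.uIcc 1 θ) := fun s hs => by
    have hs : 0 < s := zero_lt_one.trans_le (Set.uIcc_of_le hθ ▸ hs).1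
    simp only [integral_sq_inv_add_log_div_mul_rpow hs hw]
    rw [← one_div_pow, Real.sqrt_sq (by positivity)]
  rw [intervalIntegral.integral_congr h, integral_one_div_of_pos zero_lt_one hθ₀, div_one,
    abs_of_nonneg (Real.log_nonneg hθ), Real.exp_log hθ₀]
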